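/- Let f: R^n -> R be a nonzero real analytic function. Then the function log|f| is locally integrable on R^n, i.e., for every point p in R^n there is a compact neighborhood K of p such that the integral of |log|f|| over K is finite. -/

import Mathlib

open MeasureTheory

namespace LogAnalytic

open Set

/-- Constants of the sublevel set estimate. -/
noncomputable def N : ℕ → ℝ
  | 0 => 0
  | (k+1) => 2 + 2 * N k

lemma N_nonneg (k : ℕ) : 0 ≤ N k := by
  induction k with
  | zero => simp [N]
  | succ k ih => simp only [N]; linarith

lemma sublevel (k : ℕ) : ∀ (g : ℝ → ℝ), ContDiff ℝ k g → ∀ (I : Set ℝ), I.OrdConnected →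
    ∀ c : ℝ, 0 < c → (∀ t ∈ I, c ≤ iteratedDeriv k g t) → ∀ δ : ℝ, 0 < δ →
    volume (I ∩ {t | |g t| < c * δ ^ k}) ≤ ENNReal.ofReal (N k * δ) := by
  induction k with
  | zero =>
    intro g _ I _ c hc h δ hδ
    have : I ∩ {t | |g t| < c * δ ^ 0} = ∅ := by
      ext t
      simp only [mem_inter_iff, mem_ofPred_eq, mem_empty_iff_false, iff_false, not_and, not_lt]
      intro ht
      have := h t ht
      simp only [iteratedDeriv_zero] at this
      simpa using this.trans (le_abs_self _)
    rw [this]; simp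
  | succ k ih =>
    intro g hg I hI c hc h δ hδ
    set w := iteratedDeriv k g with hw
    have hdiff : Differentiable ℝ w :=
      hg.differentiable_iteratedDeriv k (by exact_mod_cast Nat.lt_succ_self k)
    have hgk : ContDiff ℝ k g := hg.of_le (by exact_mod_cast Nat.le_succ k)
    have hder : ∀ t ∈ I, c ≤ deriv w t := by
      intro t ht
      have := h t ht
      rwa [iteratedDeriv_succ] at this
    have hslope : ∀ x ∈ I, ∀ y ∈ I, x ≤ y → c * (y - x) ≤ w y - w x := by
      refine hI.convex.mul_sub_le_image_sub_of_le_deriv hdiff.continuous.continuousOn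
        hdiff.differentiableOn (fun x hx => hder x (interior_subset hx))
    have hmono : ∀ x ∈ I, ∀ y ∈ I, x ≤ y → w x ≤ w y := by
      intro x hx y hy hxy
      have := hslope x hx y hy hxy
      nlinarith [mul_nonneg hc.le (sub_nonneg.2 hxy)]
    have hcδ : 0 < c * δ := mul_pos hc hδ
    have hA : volume (I ∩ {t | |w t| < c * δ}) ≤ ENNReal.ofReal (2 * δ) := by
      refine (Real.volume_le_diam _).trans ?_
      refine Metric.ediam_le ?_
      have key : ∀ x ∈ I ∩ {t | |w t| < c * δ}, ∀ y ∈ I ∩ {t | |w t| < c * δ}, x ≤ y →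
          y - x ≤ 2 * δ := by
        rintro x ⟨hx, hx'⟩ y ⟨hy, hy'⟩ hxy
        have h1 := hslope x hx y hy hxy
        simp only [mem_ofPred_eq, abs_lt] at hx' hy'
        have : c * (y - x) ≤ c * (2 * δ) := by linarith
        exact le_of_mul_le_mul_left this hc
      intro x hx y hy
      rw [edist_dist]
      apply ENNReal.ofReal_le_ofReal
      rw [Real.dist_eq]
      rcases le_total x y with hxy | hxy
      · rw [abs_sub_comm, abs_of_nonneg (by linarith)]; exact key x hx y hy hxy
      · rw [abs_of_nonneg (by linarith)]; exact key y hy x hx hxy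
    have hB := ih g hgk (I ∩ {t | c * δ ≤ w t})
      ⟨fun x hx y hy z hz => by
        have hzI := hI.out hx.1 hy.1 hz
        exact ⟨hzI, le_trans hx.2 (hmono x hx.1 z hzI hz.1)⟩⟩ (c * δ) hcδ
      (fun t ht => ht.2) δ hδ
    have hC := ih (-g) hgk.neg (I ∩ {t | w t ≤ - (c * δ)})
      ⟨fun x hx y hy z hz => by
        have hzI := hI.out hx.1 hy.1 hz
        exact ⟨hzI, le_trans (hmono z hzI y hy.1 hz.2) hy.2⟩⟩ (c * δ) hcδ
      (fun t ht => by
        rw [iteratedDeriv_neg]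
        have := ht.2
        simp only [mem_ofPred_eq] at this
        change c * δ ≤ - w t
        linarith) δ hδ
    have hsub : I ∩ {t | |g t| < c * δ ^ (k+1)} ⊆ (I ∩ {t | |w t| < c * δ}) ∪
        (((I ∩ {t | c * δ ≤ w t}) ∩ {t | |g t| < c * δ * δ ^ k}) ∪
        ((I ∩ {t | w t ≤ - (c * δ)}) ∩ {t | |(-g) t| < c * δ * δ ^ k})) := by
      rintro t ⟨ht, ht'⟩
      simp only [mem_ofPred_eq] at ht'
      have e : c * δ ^ (k+1) = c * δ * δ ^ k := by ring
      rw [e] at ht'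
      simp only [mem_union, mem_inter_iff, mem_ofPred_eq, ht, true_and, Pi.neg_apply, abs_neg, ht',
        and_true]
      by_cases h1 : |w t| < c * δ
      · exact Or.inl h1
      · right
        rw [not_lt, le_abs] at h1
        rcases h1 with h1 | h1
        · exact Or.inl h1
        · right; linarith
    refine (measure_mono hsub).trans ((measure_union_le _ _).trans
      ((add_le_add hA ((measure_union_le _ _).trans (add_le_add hB hC))).trans ?_))
    have := N_nonneg k
    rw [← ENNReal.ofReal_add (by positivity) (by positivity),
      ← ENNReal.ofReal_add (by positivity) (by positivity)]
    apply ENNReal.ofReal_le_ofReal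
    simp only [N]
    linarith

/-- One-dimensional pointwise bound. -/
lemma pointwise (k : ℕ) (c M y : ℝ) (hc : 0 < c) (hy : |y| ≤ M)
    (hk : k = 0 → c ≤ |y|) :
    ‖Real.log |y|‖ₑ ≤ ENNReal.ofReal (M + |Real.log c|) +
      k * ∑' j : ℕ, {z : ℝ | |z| < c * ((1/2 : ℝ) ^ j) ^ k}.indicator (fun _ => (1 : ENNReal)) y := by
  have hM : 0 ≤ M := (abs_nonneg y).trans hy
  by_cases h0 : y = 0
  · simp [h0]
  have hypos : 0 < |y| := abs_pos.2 h0
  have hex : ∃ j : ℕ, c * ((1/2 : ℝ) ^ j) ^ k ≤ |y| := by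
    rcases Nat.eq_zero_or_pos k with hk0 | hk0
    · exact ⟨0, by simpa using hk hk0⟩
    · obtain ⟨j, hj⟩ := exists_pow_lt_of_lt_one (div_pos hypos hc) (show (1/2 : ℝ) < 1 by norm_num)
      refine ⟨j, ?_⟩
      have h1 : ((1/2 : ℝ) ^ j) ^ k ≤ (1/2 : ℝ) ^ j :=
        pow_le_of_le_one (by positivity) (pow_le_one₀ (by norm_num) (by norm_num)) hk0.ne'
      have h2 := h1.trans hj.le
      rw [le_div_iff₀ hc] at h2
      linarith
  classical
  set j := Nat.find hex with hj
  have hj1 : c * ((1/2 : ℝ) ^ j) ^ k ≤ |y| := Nat.find_spec hex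
  have hsum : (j : ENNReal) ≤ ∑' j : ℕ, {z : ℝ | |z| < c * ((1/2 : ℝ) ^ j) ^ k}.indicator
      (fun _ => (1 : ENNReal)) y := by
    refine le_trans ?_ (ENNReal.sum_le_tsum (Finset.range j))
    rw [Finset.sum_congr rfl (g := fun _ => (1 : ENNReal))]
    · simp
    · intro i hi
      have := Nat.find_min hex (Finset.mem_range.1 hi)
      rw [indicator_of_mem]
      simpa using this
  have hlog : |(Real.log |y|)| ≤ (M + |Real.log c|) + k * j := by
    rw [abs_le]
    have hcl := neg_abs_le (Real.log c)
    have hcl2 := abs_nonneg (Real.log c)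
    have hkj : (0 : ℝ) ≤ k * j := by positivity
    constructor
    · have h1 := Real.log_le_log (by positivity) hj1
      rw [Real.log_mul hc.ne' (by positivity), Real.log_pow, Real.log_pow, one_div,
        Real.log_inv] at h1
      have h2 : Real.log 2 ≤ 1 := by linarith [Real.log_two_lt_d9]
      nlinarith [mul_le_mul_of_nonneg_left h2 hkj]
    · have := Real.log_le_self hypos.le
      linarith
  rw [Real.enorm_eq_ofReal_abs]
  calc ENNReal.ofReal |(Real.log |y|)| ≤ ENNReal.ofReal ((M + |Real.log c|) + k * j) :=
        ENNReal.ofReal_le_ofReal hlog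
    _ = ENNReal.ofReal (M + |Real.log c|) + k * j := by
        rw [ENNReal.ofReal_add (by positivity) (by positivity), ENNReal.ofReal_mul (by positivity)]
        simp
    _ ≤ _ := by gcongr

lemma oneDim (k : ℕ) (c M r : ℝ) (hc : 0 < c) : ∃ C : ENNReal, C < ⊤ ∧
    ∀ g : ℝ → ℝ, ContDiff ℝ k g → (∀ t ∈ Icc 0 r, c ≤ iteratedDeriv k g t) →
    (∀ t ∈ Icc 0 r, |g t| ≤ M) → ∫⁻ t in Icc 0 r, ‖Real.log |g t|‖ₑ ≤ C := by
  refine ⟨ENNReal.ofReal (M + |Real.log c|) * volume (Icc 0 r) +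
    k * ∑' j : ℕ, ENNReal.ofReal (N k * (1/2 : ℝ) ^ j), ?_, ?_⟩
  · have hs : Summable fun j : ℕ => N k * (1/2 : ℝ) ^ j :=
      (summable_geometric_of_lt_one (by norm_num) (by norm_num)).mul_left _
    rw [← ENNReal.ofReal_tsum_of_nonneg (fun j => mul_nonneg (N_nonneg k) (by positivity)) hs]
    refine ENNReal.add_lt_top.2 ⟨ENNReal.mul_lt_top ENNReal.ofReal_lt_top ?_,
      ENNReal.mul_lt_top (ENNReal.natCast_lt_top k) ENNReal.ofReal_lt_top⟩
    simp
  · intro g hg hgk hgM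
    have hgm : Measurable g := hg.continuous.measurable
    have hS : ∀ j : ℕ, MeasurableSet {z : ℝ | |z| < c * ((1/2 : ℝ) ^ j) ^ k} := fun j =>
      (isOpen_lt continuous_abs continuous_const).measurableSet
    have hm : ∀ j : ℕ, Measurable fun t => {z : ℝ | |z| < c * ((1/2 : ℝ) ^ j) ^ k}.indicator
        (fun _ => (1 : ENNReal)) (g t) := fun j =>
      (measurable_const.indicator (hS j)).comp hgm
    calc ∫⁻ t in Icc 0 r, ‖Real.log |g t|‖ₑ
        ≤ ∫⁻ t in Icc 0 r, (ENNReal.ofReal (M + |Real.log c|) +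
          k * ∑' j : ℕ, {z : ℝ | |z| < c * ((1/2 : ℝ) ^ j) ^ k}.indicator
            (fun _ => (1 : ENNReal)) (g t)) := by
          refine setLIntegral_mono' measurableSet_Icc fun t ht => ?_
          refine pointwise k c M (g t) hc (hgM t ht) ?_
          rintro rfl
          have := hgk t ht
          simp only [iteratedDeriv_zero] at this
          exact this.trans (le_abs_self _)
      _ = ENNReal.ofReal (M + |Real.log c|) * volume (Icc 0 r) +
          k * ∑' j : ℕ, ∫⁻ t in Icc 0 r, {z : ℝ | |z| < c * ((1/2 : ℝ) ^ j) ^ k}.indicator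
            (fun _ => (1 : ENNReal)) (g t) := by
          rw [lintegral_add_left measurable_const, setLIntegral_const,
            lintegral_const_mul _ (Measurable.tsum hm),
            lintegral_tsum (fun j => (hm j).aemeasurable)]
      _ ≤ _ := by
          gcongr with j
          have : (fun t => {z : ℝ | |z| < c * ((1/2 : ℝ) ^ j) ^ k}.indicator
            (fun _ => (1 : ENNReal)) (g t)) =
            {t : ℝ | |g t| < c * ((1/2 : ℝ) ^ j) ^ k}.indicator (fun _ => (1 : ENNReal)) := by
            ext t; rfl
          have hT : MeasurableSet {t : ℝ | |g t| < c * ((1/2 : ℝ) ^ j) ^ k} := hgm (hS j)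
          rw [this, lintegral_indicator_const hT, one_mul, Measure.restrict_apply hT, inter_comm]
          exact sublevel k g hg _ ordConnected_Icc c hc hgk _ (by positivity)

variable {n : ℕ}

/-- Iterated directional derivative. -/
noncomputable def Dv (v : Fin n → ℝ) (f : (Fin n → ℝ) → ℝ) : ℕ → (Fin n → ℝ) → ℝ
  | 0 => f
  | (k+1) => fun x => fderiv ℝ (Dv v f k) x v

lemma Dv_analytic (v : Fin n → ℝ) (f : (Fin n → ℝ) → ℝ) (hf : ∀ x, AnalyticAt ℝ f x) (k : ℕ) :
    ∀ x, AnalyticAt ℝ (Dv v f k) x := by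
  induction k with
  | zero => exact hf
  | succ k ih =>
    intro x
    exact (ContinuousLinearMap.analyticAt (ContinuousLinearMap.apply ℝ ℝ v) _).comp (ih x).fderiv

lemma Dv_line (v : Fin n → ℝ) (f : (Fin n → ℝ) → ℝ) (hf : ∀ x, AnalyticAt ℝ f x)
    (x : Fin n → ℝ) (k : ℕ) :
    iteratedDeriv k (fun t : ℝ => f (x + t • v)) = fun t => Dv v f k (x + t • v) := by
  induction k with
  | zero => simp [Dv]
  | succ k ih =>
    rw [iteratedDeriv_succ, ih]
    ext t
    have h1 : HasFDerivAt (Dv v f k) (fderiv ℝ (Dv v f k) (x + t • v)) (x + t • v) :=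
      (Dv_analytic v f hf k _).differentiableAt.hasFDerivAt
    have h2 : HasDerivAt (fun t : ℝ => x + t • v) v t := by
      simpa using ((hasDerivAt_id t).smul_const v).const_add x
    exact (h1.comp_hasDerivAt t h2).deriv

lemma line_analytic (v : Fin n → ℝ) (f : (Fin n → ℝ) → ℝ) (hf : ∀ x, AnalyticAt ℝ f x)
    (x : Fin n → ℝ) (t : ℝ) : AnalyticAt ℝ (fun t : ℝ => f (x + t • v)) t := by
  have : AnalyticAt ℝ (fun t : ℝ => x + t • v) t := by fun_prop
  exact AnalyticAt.fun_comp (hf _) this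

lemma exists_ne (f : (Fin n → ℝ) → ℝ) (hf : ∀ x, AnalyticAt ℝ f x) (hne : f ≠ 0)
    (p : Fin n → ℝ) : ∃ v k, Dv v f k p ≠ 0 := by
  by_contra! H
  apply hne
  ext x
  set v := x - p
  have han := line_analytic v f hf p
  have h0 : ∀ k, iteratedDeriv k (fun t : ℝ => f (p + t • v)) 0 = 0 := by
    intro k
    rw [Dv_line v f hf p k]
    simpa using H v k
  have hev : (fun t : ℝ => f (p + t • v)) =ᶠ[nhds 0] 0 := by
    have hs := (han 0).hasFPowerSeriesAt
    have : (FormalMultilinearSeries.ofScalars ℝ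
        fun n => iteratedDeriv n (fun t : ℝ => f (p + t • v)) 0 / (n.factorial : ℝ)) = 0 := by
      ext n
      simp [h0]
    rw [this] at hs
    exact hs.eventually_eq_zero
  have hall := AnalyticOnNhd.eq_of_eventuallyEq (g := fun _ => (0 : ℝ)) (fun t _ => han t)
    (fun t _ => analyticAt_const) hev
  have := congrFun hall 1
  simpa [v] using this

lemma main_pos (f : (Fin n → ℝ) → ℝ) (hf : ∀ x, AnalyticAt ℝ f x) (p v : Fin n → ℝ) (k : ℕ)
    (hpos : 0 < Dv v f k p) :
    ∃ K : Set (Fin n → ℝ), IsCompact K ∧ K ∈ nhds p ∧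
      IntegrableOn (fun x => Real.log |f x|) K volume := by
  have hfc : Continuous f := continuous_iff_continuousAt.2 fun x => (hf x).continuousAt
  set c := Dv v f k p / 2 with hc
  have hcpos : 0 < c := by positivity
  have e1 : ∀ᶠ y in nhds p, c ≤ Dv v f k y :=
    (Dv_analytic v f hf k p).continuousAt.eventually (eventually_ge_nhds (by linarith))
  have e2 : ∀ᶠ y in nhds p, |f y| ≤ |f p| + 1 :=
    hfc.abs.continuousAt.eventually (eventually_le_nhds (by linarith))
  obtain ⟨ρ, hρ, hball⟩ := Metric.eventually_nhds_iff.1 (e1.and e2)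
  set r := ρ / (2 * (1 + 2 * ‖v‖)) with hr
  have hv := norm_nonneg v
  have hrpos : 0 < r := by positivity
  have hrρ : r + 2 * (r * ‖v‖) < ρ := by
    have : r * (2 * (1 + 2 * ‖v‖)) = ρ := by rw [hr]; field_simp
    nlinarith
  obtain ⟨C, hCtop, hC⟩ := oneDim k c (|f p| + 1) r hcpos
  refine ⟨Metric.closedBall p r, isCompact_closedBall _ _, Metric.closedBall_mem_nhds _ hrpos, ?_⟩
  set F : (Fin n → ℝ) → ENNReal := fun x => ‖Real.log |f x|‖ₑ with hF
  have hmeas : Measurable fun x => Real.log |f x| := Real.measurable_log.comp hfc.abs.measurable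
  have hFm : Measurable F := hmeas.enorm
  refine ⟨hmeas.aestronglyMeasurable, ?_⟩
  change ∫⁻ x in Metric.closedBall p r, F x < ⊤
  set B := Metric.closedBall p (r + r * ‖v‖) with hB
  have hnorm : ∀ t ∈ Icc 0 r, ‖t • v‖ ≤ r * ‖v‖ := by
    intro t ht
    rw [norm_smul, Real.norm_eq_abs, abs_of_nonneg ht.1]
    exact mul_le_mul_of_nonneg_right ht.2 hv
  have hshift : ∀ t ∈ Icc 0 r, ∫⁻ x in Metric.closedBall p r, F x ≤
      ∫⁻ x in B, F (x + t • v) := by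
    intro t ht
    rw [← lintegral_indicator Metric.isClosed_closedBall.measurableSet,
      ← lintegral_indicator Metric.isClosed_closedBall.measurableSet,
      ← lintegral_add_right_eq_self _ (t • v)]
    refine lintegral_mono fun x => ?_
    by_cases hx : x + t • v ∈ Metric.closedBall p r
    · have hxB : x ∈ B := by
        rw [hB, mem_closedBall_iff_norm]
        rw [mem_closedBall_iff_norm] at hx
        have h1 : x - p = (x + t • v - p) - t • v := by abel
        rw [h1]
        exact (norm_sub_le _ _).trans (add_le_add hx (hnorm t ht))
      simp only [indicator_of_mem hx]
      rw [indicator_of_mem hxB]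
    · simp [indicator_of_notMem hx]
  have hline : ∀ x ∈ B, ∫⁻ t in Icc 0 r, F (x + t • v) ≤ C := by
    intro x hx
    have hd : ∀ t ∈ Icc 0 r, dist (x + t • v) p < ρ := by
      intro t ht
      rw [hB, mem_closedBall_iff_norm] at hx
      rw [dist_eq_norm]
      have h1 : x + t • v - p = (x - p) + t • v := by abel
      rw [h1]
      have := norm_add_le (x - p) (t • v)
      have := hnorm t ht
      linarith
    refine hC (fun t => f (x + t • v)) ?_ ?_ ?_
    · exact contDiff_iff_contDiffAt.2 fun t => (line_analytic v f hf x t).contDiffAt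
    · intro t ht
      rw [Dv_line v f hf x k]
      exact (hball (hd t ht)).1
    · intro t ht
      exact (hball (hd t ht)).2
  have hJ : ENNReal.ofReal r * ∫⁻ x in Metric.closedBall p r, F x ≤ C * volume B := by
    calc ENNReal.ofReal r * ∫⁻ x in Metric.closedBall p r, F x
        = ∫⁻ _ in Icc 0 r, ∫⁻ x in Metric.closedBall p r, F x := by
          rw [setLIntegral_const, Real.volume_Icc, sub_zero, mul_comm]
      _ ≤ ∫⁻ t in Icc 0 r, ∫⁻ x in B, F (x + t • v) :=
          setLIntegral_mono' measurableSet_Icc hshift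
      _ = ∫⁻ x in B, ∫⁻ t in Icc 0 r, F (x + t • v) := by
          refine lintegral_lintegral_swap ?_
          refine (hFm.comp ?_).aemeasurable
          fun_prop
      _ ≤ ∫⁻ _ in B, C := setLIntegral_mono' Metric.isClosed_closedBall.measurableSet hline
      _ = C * volume B := setLIntegral_const _ _
  have hfin : C * volume B < ⊤ :=
    ENNReal.mul_lt_top hCtop (isCompact_closedBall _ _).measure_lt_top
  by_contra hcon
  rw [not_lt, top_le_iff] at hcon
  rw [hcon, ENNReal.mul_top (by simpa using hrpos)] at hJ
  exact absurd hfin (not_lt.2 hJ)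

lemma Dv_neg (v : Fin n → ℝ) (f : (Fin n → ℝ) → ℝ) (k : ℕ) :
    Dv v (-f) k = - Dv v f k := by
  induction k with
  | zero => rfl
  | succ k ih =>
    ext x
    simp only [Dv, ih, fderiv_neg, Pi.neg_apply]
    rfl

end LogAnalytic

theorem log_abs_of_analytic_locallyIntegrable (n : ℕ) (f : (Fin n → ℝ) → ℝ)
    (hf : ∀ x, AnalyticAt ℝ f x) (hne : f ≠ 0) :
    ∀ p : Fin n → ℝ, ∃ K : Set (Fin n → ℝ), IsCompact K ∧ K ∈ nhds p ∧
      IntegrableOn (fun x => Real.log |f x|) K volume := by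
  intro p
  obtain ⟨v, k, hk⟩ := LogAnalytic.exists_ne f hf hne p
  rcases lt_or_gt_of_ne hk with h | h
  · have := LogAnalytic.main_pos (-f) (fun x => (hf x).neg) p v k
      (by rw [LogAnalytic.Dv_neg]; simpa using h)
    simpa using this
  · exact LogAnalytic.main_pos f hf p v k h
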